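/- Let α ∈ ℝ, let (q_n) be a sequence of positive integers with Σ_{j≥2} ‖q_j α‖ < ∞, and let s ∈ {−1, 1}. Then the set of x ∈ 𝕋 such that T(q_1(x + α)) = T(q_1 x) + 2s and T(q_j(x + α)) = T(q_j x) for every j ≥ 2 has Lebesgue measure at least ‖q_1 α‖ − 2·Σ_{j≥2} ‖q_j α‖. -/

import Mathlib

open MeasureTheory

/-- The Haar function `T : 𝕋 → ℤ`, equal to `1` on `[0,1/2)` and `-1` on `[1/2,1)`. -/
noncomputable def haarT (x : UnitAddCircle) : ℤ :=
  if (AddCircle.equivIco 1 0 x : ℝ) < 1/2 then 1 else -1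

lemma haarT_coe (t : ℝ) :
    haarT (t : UnitAddCircle) = if Int.fract t < 1 / 2 then 1 else -1 := by
  have h : (AddCircle.equivIco 1 0 (t : UnitAddCircle) : ℝ) = Int.fract t := by
    simp
  rw [haarT, h]

lemma haarT_coe_eq_one {t : ℝ} (n : ℤ) (h₁ : n ≤ t) (h₂ : t < n + 1 / 2) :
    haarT (t : UnitAddCircle) = 1 := by
  have hn : ⌊t⌋ = n := Int.floor_eq_iff.2 ⟨h₁, by linarith⟩
  rw [haarT_coe, Int.fract, hn, if_pos (by linarith)]

lemma haarT_coe_eq_neg_one {t : ℝ} (n : ℤ) (h₁ : n + 1 / 2 ≤ t) (h₂ : t < n + 1) :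
    haarT (t : UnitAddCircle) = -1 := by
  have hn : ⌊t⌋ = n := Int.floor_eq_iff.2 ⟨by linarith, h₂⟩
  rw [haarT_coe, Int.fract, hn, if_neg (by linarith)]

lemma measurable_haarT : Measurable haarT := by
  have h : Measurable (fun x : UnitAddCircle => (AddCircle.equivIco 1 0 x : ℝ)) :=
    measurable_subtype_coe.comp (AddCircle.measurableEquivIco 1 0).measurable
  exact Measurable.ite (measurableSet_lt h measurable_const) measurable_const measurable_const

lemma measurableSet_haarT_add_eq (β : UnitAddCircle) (c : ℤ) :
    MeasurableSet {y : UnitAddCircle | haarT (y + β) = haarT y + c} :=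
  measurableSet_eq_fun (measurable_haarT.comp (measurable_add_const β))
    (measurable_haarT.add_const c)

lemma UnitAddCircle.volume_eq_volume_preimage_inter_Ioc (a : ℝ) {S : Set UnitAddCircle}
    (hS : MeasurableSet S) :
    volume S = volume ((fun t : ℝ => (t : UnitAddCircle)) ⁻¹' S ∩ Set.Ioc a (a + 1)) := by
  have h := UnitAddCircle.measurePreserving_mk a
  rw [← h.measure_preimage hS.nullMeasurableSet, Measure.restrict_apply (h.measurable hS)]

lemma UnitAddCircle.exists_coe_eq_abs_eq_norm (β : UnitAddCircle) :
    ∃ b : ℝ, (b : UnitAddCircle) = β ∧ |b| = ‖β‖ ∧ |b| ≤ 1 / 2 := by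
  obtain ⟨t, rfl⟩ := QuotientAddGroup.mk_surjective β
  refine ⟨t - round t, ?_, (UnitAddCircle.norm_eq (x := t)).symm, abs_sub_round t⟩
  have h : ((round t : ℝ) : UnitAddCircle) = 0 := by
    rw [AddCircle.coe_eq_zero_iff]
    exact ⟨round t, by simp⟩
  rw [AddCircle.coe_sub, h, sub_zero]

lemma volume_ge_of_forall_coe_mem_Ioo {S : Set UnitAddCircle} (hS : MeasurableSet S) (c d : ℝ)
    (hd : d ≤ c + 1) (h : ∀ t : ℝ, c < t → t < d → (t : UnitAddCircle) ∈ S) :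
    ENNReal.ofReal (d - c) ≤ volume S := by
  rw [UnitAddCircle.volume_eq_volume_preimage_inter_Ioc c hS, ← Real.volume_Ioo]
  exact measure_mono fun t ht => ⟨h t ht.1 ht.2, ht.1, by linarith [ht.2]⟩

lemma norm_le_volume_haarT_jump (β : UnitAddCircle) {s : ℤ} (hs : s = 1 ∨ s = -1) :
    ENNReal.ofReal ‖β‖ ≤ volume {y : UnitAddCircle | haarT (y + β) = haarT y + 2 * s} := by
  obtain ⟨b, rfl, hb, hb'⟩ := UnitAddCircle.exists_coe_eq_abs_eq_norm β
  rw [← hb]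
  have hm := measurableSet_haarT_add_eq (b : UnitAddCircle) (2 * s)
  have key := volume_ge_of_forall_coe_mem_Ioo hm
  simp only [Set.mem_ofPred_eq, ← AddCircle.coe_add] at key
  rcases hs with rfl | rfl <;> rcases le_total 0 b with h0 | h0
  · rw [abs_of_nonneg h0] at *
    refine le_trans (le_of_eq (by ring_nf)) (key (1 - b) 1 (by linarith) fun t h1 h2 => ?_)
    rw [haarT_coe_eq_neg_one (t := t) 0, haarT_coe_eq_one 1] <;> push_cast <;> linarith
  · rw [abs_of_nonpos h0] at *
    refine le_trans (le_of_eq (by ring_nf)) (key (1 / 2) (1 / 2 - b) (by linarith)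
      fun t h1 h2 => ?_)
    rw [haarT_coe_eq_neg_one (t := t) 0, haarT_coe_eq_one 0] <;> push_cast <;> linarith
  · rw [abs_of_nonneg h0] at *
    refine le_trans (le_of_eq (by ring_nf)) (key (1 / 2 - b) (1 / 2) (by linarith)
      fun t h1 h2 => ?_)
    rw [haarT_coe_eq_one (t := t) 0, haarT_coe_eq_neg_one 0] <;> push_cast <;> linarith
  · rw [abs_of_nonpos h0] at *
    refine le_trans (le_of_eq (by ring_nf)) (key 0 (-b) (by linarith) fun t h1 h2 => ?_)
    rw [haarT_coe_eq_one (t := t) 0, haarT_coe_eq_neg_one (-1)] <;> push_cast <;> linarith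

lemma measurableSet_haarT_add_ne (β : UnitAddCircle) :
    MeasurableSet {y : UnitAddCircle | haarT (y + β) ≠ haarT y} := by
  have h := (measurableSet_haarT_add_eq β 0).compl
  simp only [add_zero] at h
  exact h

lemma volume_haarT_add_ne_le (β : UnitAddCircle) :
    volume {y : UnitAddCircle | haarT (y + β) ≠ haarT y} ≤ ENNReal.ofReal (2 * ‖β‖) := by
  obtain ⟨b, rfl, hb, hb'⟩ := UnitAddCircle.exists_coe_eq_abs_eq_norm β
  rw [← hb, UnitAddCircle.volume_eq_volume_preimage_inter_Ioc 0 (measurableSet_haarT_add_ne _)]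
  obtain ⟨c, hc⟩ : ∃ c : ℝ, (fun t : ℝ => (t : UnitAddCircle)) ⁻¹'
      {y : UnitAddCircle | haarT (y + b) ≠ haarT y} ∩ Set.Ioc 0 (0 + 1) ⊆
      (Set.Icc c (c + |b|) ∪ Set.Icc (c + 1 / 2) (c + 1 / 2 + |b|)) ∪ {1} := by
    rcases le_total 0 b with h0 | h0
    · rw [abs_of_nonneg h0] at *
      refine ⟨1 / 2 - b, fun t ⟨ht, h1, h2⟩ => ?_⟩
      simp only [Set.mem_preimage, Set.mem_ofPred_eq, ← AddCircle.coe_add] at ht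
      simp only [Set.mem_union, Set.mem_Icc, Set.mem_singleton_iff]
      by_contra! hn
      obtain ⟨⟨h3, h4⟩, h5⟩ := hn
      have h6 : t < 1 := lt_of_le_of_ne (by linarith) h5
      apply ht
      rcases lt_or_ge t (1 / 2 - b) with h7 | h7
      · rw [haarT_coe_eq_one (t := t) 0, haarT_coe_eq_one 0] <;> push_cast <;> linarith
      · have h8 := h3 h7
        have h9 : t < 1 - b := by
          by_contra! h
          linarith [h4 (by linarith)]
        rw [haarT_coe_eq_neg_one (t := t) 0, haarT_coe_eq_neg_one 0] <;> push_cast <;> linarith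
    · rw [abs_of_nonpos h0] at *
      refine ⟨0, fun t ⟨ht, h1, h2⟩ => ?_⟩
      simp only [Set.mem_preimage, Set.mem_ofPred_eq, ← AddCircle.coe_add] at ht
      simp only [Set.mem_union, Set.mem_Icc, Set.mem_singleton_iff]
      by_contra! hn
      obtain ⟨⟨h3, h4⟩, h5⟩ := hn
      have h6 : t < 1 := lt_of_le_of_ne (by linarith) h5
      have h7 := h3 h1.le
      apply ht
      rcases lt_or_ge t (1 / 2) with h8 | h8
      · rw [haarT_coe_eq_one (t := t) 0, haarT_coe_eq_one 0] <;> push_cast <;> linarith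
      · have h9 := h4 (by linarith)
        rw [haarT_coe_eq_neg_one (t := t) 0, haarT_coe_eq_neg_one 0] <;> push_cast <;> linarith
  refine (measure_mono hc).trans ((measure_union_le _ _).trans ?_)
  rw [Real.volume_singleton, add_zero]
  refine (measure_union_le _ _).trans (le_of_eq ?_)
  rw [Real.volume_Icc, Real.volume_Icc, add_sub_cancel_left, add_sub_cancel_left,
    ← ENNReal.ofReal_add (abs_nonneg b) (abs_nonneg b), two_mul]

lemma UnitAddCircle.measurePreserving_nsmul {n : ℕ} (hn : 0 < n) :
    MeasurePreserving (fun x : UnitAddCircle => n • x) volume volume := by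
  simpa using MeasureTheory.Measure.measurePreserving_zsmul (volume : Measure UnitAddCircle)
    (n := (n : ℤ)) (by exact_mod_cast hn.ne')

/-- for `α ∈ ℝ`, positive integers `(q_n)` (here `q 0` is the paper's `q_1` and
`q (j+1)` for `j : ℕ` runs over the paper's `q_j`, `j ≥ 2`) with `Σ_{j≥2} ‖q_j α‖ < ∞`, and
`s ∈ {-1, 1}`, the set of `x ∈ 𝕋` with `T(q_1(x+α)) = T(q_1 x) + 2s` and
`T(q_j(x+α)) = T(q_j x)` for all `j ≥ 2` has Lebesgue measure at least
`‖q_1 α‖ - 2 Σ_{j≥2} ‖q_j α‖`. -/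
theorem statement6 (α : ℝ) (q : ℕ → ℕ) (hq : ∀ j, 0 < q j)
    (hsum : Summable (fun j : ℕ => ‖(((q (j + 1) : ℝ) * α : ℝ) : UnitAddCircle)‖))
    (s : ℤ) (hs : s = 1 ∨ s = -1) :
    ENNReal.ofReal (‖(((q 0 : ℝ) * α : ℝ) : UnitAddCircle)‖
        - 2 * ∑' j : ℕ, ‖(((q (j + 1) : ℝ) * α : ℝ) : UnitAddCircle)‖)
      ≤ (volume : Measure UnitAddCircle)
        {x : UnitAddCircle |
          haarT (q 0 • (x + (α : UnitAddCircle))) = haarT (q 0 • x) + 2 * s ∧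
          ∀ j : ℕ, haarT (q (j + 1) • (x + (α : UnitAddCircle))) = haarT (q (j + 1) • x)} := by
  have hmul (j : ℕ) (x : UnitAddCircle) : q j • (x + (α : UnitAddCircle)) =
      q j • x + (((q j : ℝ) * α : ℝ) : UnitAddCircle) := by
    rw [smul_add, ← AddCircle.coe_nsmul, nsmul_eq_mul]
  simp only [hmul]
  set β : ℕ → UnitAddCircle := fun j => (((q j : ℝ) * α : ℝ) : UnitAddCircle)
  set A : Set UnitAddCircle := (fun x => q 0 • x) ⁻¹' {y | haarT (y + β 0) = haarT y + 2 * s}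
  set D : ℕ → Set UnitAddCircle := fun j =>
    (fun x => q (j + 1) • x) ⁻¹' {y | haarT (y + β (j + 1)) ≠ haarT y}
  have hA : ENNReal.ofReal ‖β 0‖ ≤ volume A := by
    rw [(UnitAddCircle.measurePreserving_nsmul (hq 0)).measure_preimage
      (measurableSet_haarT_add_eq _ _).nullMeasurableSet]
    exact norm_le_volume_haarT_jump _ hs
  have hD : volume (⋃ j, D j) ≤ ENNReal.ofReal (2 * ∑' j, ‖β (j + 1)‖) := by
    rw [← tsum_mul_left, ENNReal.ofReal_tsum_of_nonneg (fun j => by positivity)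
      (hsum.mul_left 2)]
    refine (measure_iUnion_le _).trans (ENNReal.tsum_le_tsum fun j => ?_)
    rw [(UnitAddCircle.measurePreserving_nsmul (hq (j + 1))).measure_preimage
      (measurableSet_haarT_add_ne _).nullMeasurableSet]
    exact volume_haarT_add_ne_le _
  calc ENNReal.ofReal (‖β 0‖ - 2 * ∑' j, ‖β (j + 1)‖)
      = ENNReal.ofReal ‖β 0‖ - ENNReal.ofReal (2 * ∑' j, ‖β (j + 1)‖) :=
        ENNReal.ofReal_sub _ (by positivity)
    _ ≤ volume A - volume (⋃ j, D j) := tsub_le_tsub hA hD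
    _ ≤ volume (A \ ⋃ j, D j) := le_measure_sdiff
    _ ≤ _ := by
        refine measure_mono fun x hx => ⟨hx.1, fun j => ?_⟩
        by_contra hj
        exact hx.2 (Set.mem_iUnion.2 ⟨j, hj⟩)
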